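/- arXiv:2506.02219 — 3 statements merged into one kernel-verified Lean document; each statement's English description precedes it below -/
import Mathlib

section
/- Let M ≥ 1, let p : Fin M → ℝ³ be source points with masses m : Fin M → ℝ, let f : ℝ³ → ℝ³ → ℝ be a kernel, and let q ∈ ℝ³. Assume a path structure on the sources (all paths share a common root, paths are prefix-consistent, leaves identify sources, every node's aggregate mass is positive, and leaf centers of mass coincide with the corresponding source points). Let the path index I be sampled with probabilities P(I = i) > 0 for every i, and, given I = i, let the path length K be sampled by Russian roulette with continuation probabilities p_{i,k} ∈ (0,1], i.e. P(K = ℓ | I = i) = (∏_{j=0}^{ℓ−1} p_{i,j})(1 − p_{i,ℓ}) for ℓ < d_i and P(K = d_i | I = i) = ∏_{j=0}^{d_i−1} p_{i,j}. Then the single-path estimator F̂₁(q) = m̃_{T_{I,0}} f(p̃_{T_{I,0}}, q) + Σ_{k=1}^{K} Δ_{I,k−1} / (P(I ∈ T_{I,k−1}) · P(K ≥ k | I)) is an unbiased estimator of the kernel sum: E[F̂₁(q)] = F(q) = Σ_{i=1}^{M} m_i f(p_i, q). -/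
open Finset

noncomputable section

-- The point set of node `a`: the source indices whose path passes through `a`.
open Classical in
def nodeSet {M : ℕ} {α : Type*} (d : Fin M → ℕ) (T : Fin M → ℕ → α) (a : α) :
    Finset (Fin M) :=
  Finset.univ.filter fun j => ∃ k ≤ d j, T j k = a

/-- The aggregate mass `m̃_a` of node `a`. -/
def aggMass {M : ℕ} {α : Type*} (d : Fin M → ℕ) (T : Fin M → ℕ → α) (m : Fin M → ℝ)
    (a : α) : ℝ :=
  ∑ j ∈ nodeSet d T a, m j

/-- The center of mass `p̃_a` of node `a`. -/
def com {M : ℕ} {α : Type*} (d : Fin M → ℕ) (T : Fin M → ℕ → α) (m : Fin M → ℝ)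
    (p : Fin M → EuclideanSpace ℝ (Fin 3)) (a : α) : EuclideanSpace ℝ (Fin 3) :=
  (aggMass d T m a)⁻¹ • ∑ j ∈ nodeSet d T a, m j • p j

-- The children `C(a)` of node `a`.
open Classical in
def children {M : ℕ} {α : Type*} (d : Fin M → ℕ) (T : Fin M → ℕ → α) (a : α) :
    Finset α :=
  ((Finset.univ ×ˢ Finset.range (Finset.univ.sup d + 1)).filter
      fun jk : Fin M × ℕ => jk.2 + 1 ≤ d jk.1 ∧ T jk.1 jk.2 = a).image
    fun jk => T jk.1 (jk.2 + 1)

/-- The contribution swap `Δ_{i,k}` at node `T_{i,k}`. -/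
def contribSwap {M : ℕ} {α : Type*} (d : Fin M → ℕ) (T : Fin M → ℕ → α) (m : Fin M → ℝ)
    (p : Fin M → EuclideanSpace ℝ (Fin 3))
    (f : EuclideanSpace ℝ (Fin 3) → EuclideanSpace ℝ (Fin 3) → ℝ)
    (q : EuclideanSpace ℝ (Fin 3)) (i : Fin M) (k : ℕ) : ℝ :=
  (∑ c ∈ children d T (T i k), aggMass d T m c * f (com d T m p c) q) -
    aggMass d T m (T i k) * f (com d T m p (T i k)) q

/-- The Russian roulette path-length distribution `P(K = ℓ ∣ I = i)` with continuation
probabilities `prr i 0, prr i 1, …`. -/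
def lenProb {M : ℕ} (d : Fin M → ℕ) (prr : Fin M → ℕ → ℝ) (i : Fin M) (ℓ : ℕ) : ℝ :=
  if ℓ < d i then (∏ j ∈ Finset.range ℓ, prr i j) * (1 - prr i ℓ)
  else ∏ j ∈ Finset.range (d i), prr i j

/-- The value of the single-path estimator `F̂₁(q)` for the sample `(I, K) = (i, ℓ)`:
`m̃_{T_{i,0}} f(p̃_{T_{i,0}}, q) + ∑_{k=1}^{ℓ} Δ_{i,k-1} / (P(I ∈ T_{i,k-1}) · P(K ≥ k ∣ I = i))`. -/
def pathEstimate {M : ℕ} {α : Type*} (d : Fin M → ℕ) (T : Fin M → ℕ → α) (m : Fin M → ℝ)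
    (p : Fin M → EuclideanSpace ℝ (Fin 3))
    (f : EuclideanSpace ℝ (Fin 3) → EuclideanSpace ℝ (Fin 3) → ℝ)
    (q : EuclideanSpace ℝ (Fin 3)) (w : Fin M → ℝ) (prr : Fin M → ℕ → ℝ)
    (i : Fin M) (ℓ : ℕ) : ℝ :=
  aggMass d T m (T i 0) * f (com d T m p (T i 0)) q +
    ∑ k ∈ Finset.Icc 1 ℓ,
      contribSwap d T m p f q i (k - 1) /
        ((∑ j ∈ nodeSet d T (T i (k - 1)), w j) * ∏ j ∈ Finset.range k, prr i j)

/-- Averaging a function of a Russian roulette length amounts to weighting its increments by the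
survival probabilities. -/
theorem russianRoulette_sum (P : ℕ → ℝ) (G : ℕ → ℝ) (n : ℕ) :
    ∑ ℓ ∈ range n, (∏ j ∈ range ℓ, P j) * (1 - P ℓ) * G ℓ + (∏ j ∈ range n, P j) * G n
      = G 0 + ∑ k ∈ range n, (∏ j ∈ range (k + 1), P j) * (G (k + 1) - G k) := by
  induction n with
  | zero => simp
  | succ n ih =>
    rw [sum_range_succ, sum_range_succ (fun k => _ * (G (k + 1) - G k)), ← add_assoc, ← ih,
      prod_range_succ]
    ring

theorem sum_lenProb_mul {M : ℕ} (d : Fin M → ℕ) (prr : Fin M → ℕ → ℝ) (i : Fin M)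
    (G : ℕ → ℝ) :
    ∑ ℓ ∈ range (d i + 1), lenProb d prr i ℓ * G ℓ
      = G 0 + ∑ k ∈ range (d i), (∏ j ∈ range (k + 1), prr i j) * (G (k + 1) - G k) := by
  rw [← russianRoulette_sum, sum_range_succ]
  congr 1
  · refine sum_congr rfl fun ℓ hℓ => ?_
    rw [lenProb, if_pos (mem_range.1 hℓ)]
  · simp [lenProb]

/-- Conditionally on the path index, averaging over the path length removes the survival
probabilities from the estimator. -/
theorem sum_lenProb_mul_pathEstimate {M : ℕ} {α : Type*} (d : Fin M → ℕ) (T : Fin M → ℕ → α)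
    (m : Fin M → ℝ) (p : Fin M → EuclideanSpace ℝ (Fin 3))
    (f : EuclideanSpace ℝ (Fin 3) → EuclideanSpace ℝ (Fin 3) → ℝ)
    (q : EuclideanSpace ℝ (Fin 3)) (w : Fin M → ℝ) (prr : Fin M → ℕ → ℝ) (i : Fin M)
    (hprr : ∀ k < d i, prr i k ≠ 0) :
    ∑ ℓ ∈ range (d i + 1), lenProb d prr i ℓ * pathEstimate d T m p f q w prr i ℓ
      = aggMass d T m (T i 0) * f (com d T m p (T i 0)) q +
        ∑ k ∈ range (d i), contribSwap d T m p f q i k / ∑ j ∈ nodeSet d T (T i k), w j := by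
  rw [sum_lenProb_mul]
  congr 1
  · simp [pathEstimate]
  · refine sum_congr rfl fun k hk => ?_
    have hP : ∏ j ∈ range (k + 1), prr i j ≠ 0 :=
      prod_ne_zero_iff.2 fun j hj => hprr j (by simp at hj hk; omega)
    simp only [pathEstimate]
    rw [sum_Icc_succ_top (by omega), Nat.add_sub_cancel, add_sub_add_left_eq_sub,
      add_sub_cancel_left, mul_comm, div_mul_eq_mul_div, mul_div_mul_right _ _ hP]

/-- The positions `(i, k)` of the internal nodes on the paths. -/
def internalPos {M : ℕ} (d : Fin M → ℕ) : Finset (Σ _ : Fin M, ℕ) :=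
  univ.sigma fun i => range (d i)

theorem mem_internalPos {M : ℕ} {d : Fin M → ℕ} {x : Σ _ : Fin M, ℕ} :
    x ∈ internalPos d ↔ x.2 < d x.1 := by
  simp [internalPos]

section PathStructure

variable {M : ℕ} {α : Type*} {d : Fin M → ℕ} {T : Fin M → ℕ → α}

theorem mem_nodeSet {a : α} {j : Fin M} : j ∈ nodeSet d T a ↔ ∃ k ≤ d j, T j k = a := by
  simp [nodeSet]

theorem mem_children {a b : α} :
    b ∈ children d T a ↔ ∃ j k, k < d j ∧ T j k = a ∧ T j (k + 1) = b := by
  simp only [children, mem_image, mem_filter, mem_product, mem_univ, true_and, mem_range,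
    Prod.exists]
  constructor
  · rintro ⟨j, k, ⟨-, h, ha⟩, hb⟩
    exact ⟨j, k, h, ha, hb⟩
  · rintro ⟨j, k, h, ha, hb⟩
    have := le_sup (f := d) (mem_univ j)
    exact ⟨j, k, ⟨by omega, h, ha⟩, hb⟩

theorem nodeSet_leaf (hleaf : ∀ i j k, k ≤ d j → T i (d i) = T j k → i = j ∧ k = d j)
    (i : Fin M) : nodeSet d T (T i (d i)) = {i} := by
  ext j
  rw [mem_nodeSet, mem_singleton]
  constructor
  · rintro ⟨k, hk, h⟩
    exact (hleaf i j k hk h.symm).1.symm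
  · rintro rfl
    exact ⟨d j, le_rfl, rfl⟩

open Classical in
/-- The paths through an internal node are exactly the paths that have it as an internal node. -/
theorem sum_internalPos_fiber
    (hprefix : ∀ i j k k', k ≤ d i → k' ≤ d j → T i k = T j k' →
      k = k' ∧ ∀ l ≤ k, T i l = T j l)
    (hleaf : ∀ i j k, k ≤ d j → T i (d i) = T j k → i = j ∧ k = d j)
    (w : Fin M → ℝ) {i : Fin M} {k : ℕ} (hk : k < d i) :
    ∑ x ∈ internalPos d with T x.1 x.2 = T i k, w x.1 = ∑ j ∈ nodeSet d T (T i k), w j := by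
  refine sum_nbij (fun x => x.1) ?_ ?_ ?_ (fun _ _ => rfl)
  · rintro ⟨j, l⟩ hx
    simp only [mem_filter, mem_internalPos] at hx
    exact mem_nodeSet.2 ⟨l, hx.1.le, hx.2⟩
  · rintro ⟨j, l⟩ hx ⟨j', l'⟩ hx' h
    simp only [coe_filter, Set.mem_ofPred_eq, mem_internalPos] at hx hx' h
    subst h
    rw [(hprefix _ _ _ _ hx.1.le hx'.1.le (hx.2.trans hx'.2.symm)).1]
  · intro j hj
    obtain ⟨l, hl, h⟩ := mem_nodeSet.1 hj
    refine ⟨⟨j, l⟩, ?_, rfl⟩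
    simp only [coe_filter, Set.mem_ofPred_eq, mem_internalPos]
    refine ⟨lt_of_le_of_ne hl ?_, h⟩
    rintro rfl
    exact hk.ne (hleaf j i k hk.le h).2

open Classical in
/-- Importance sampling of the internal nodes along a random path. -/
theorem sum_internalPos_div
    (hprefix : ∀ i j k k', k ≤ d i → k' ≤ d j → T i k = T j k' →
      k = k' ∧ ∀ l ≤ k, T i l = T j l)
    (hleaf : ∀ i j k, k ≤ d j → T i (d i) = T j k → i = j ∧ k = d j)
    (w : Fin M → ℝ) (hw : ∀ i, 0 < w i) (g : α → ℝ) :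
    ∑ x ∈ internalPos d, w x.1 * (g (T x.1 x.2) / ∑ j ∈ nodeSet d T (T x.1 x.2), w j)
      = ∑ a ∈ (internalPos d).image (fun x => T x.1 x.2), g a := by
  symm
  refine sum_image' _ ?_
  rintro ⟨i, k⟩ hx
  rw [mem_internalPos] at hx
  have hpos : 0 < ∑ j ∈ nodeSet d T (T i k), w j :=
    sum_pos (fun j _ => hw j) ⟨i, mem_nodeSet.2 ⟨k, hx.le, rfl⟩⟩
  rw [sum_congr rfl (g := fun x => w x.1 * (g (T i k) / ∑ j ∈ nodeSet d T (T i k), w j))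
    fun x h => by rw [(mem_filter.1 h).2], ← sum_mul, sum_internalPos_fiber hprefix hleaf w hx,
    mul_div_cancel₀ _ hpos.ne']

open Classical in
theorem sum_children
    (hprefix : ∀ i j k k', k ≤ d i → k' ≤ d j → T i k = T j k' →
      k = k' ∧ ∀ l ≤ k, T i l = T j l) (h : α → ℝ) :
    ∑ a ∈ (internalPos d).image (fun x => T x.1 x.2), ∑ c ∈ children d T a, h c
      = ∑ c ∈ (internalPos d).image (fun x => T x.1 (x.2 + 1)), h c := by
  rw [← sum_biUnion]
  · congr 1
    ext c
    simp only [mem_biUnion, mem_image, mem_children, mem_internalPos, Sigma.exists]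
    constructor
    · rintro ⟨_, -, j, k, hk, -, rfl⟩
      exact ⟨j, k, hk, rfl⟩
    · rintro ⟨j, k, hk, rfl⟩
      exact ⟨_, ⟨j, k, hk, rfl⟩, j, k, hk, rfl, rfl⟩
  · intro a _ b _ hab
    refine disjoint_left.2 fun c hca hcb => hab ?_
    obtain ⟨i, k, hk, rfl, rfl⟩ := mem_children.1 hca
    obtain ⟨j, l, hl, rfl, hc⟩ := mem_children.1 hcb
    obtain ⟨hkl, heq⟩ := hprefix i j (k + 1) (l + 1) hk hl hc.symm
    obtain rfl : k = l := by omega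
    exact heq k (by omega)

open Classical in
/-- Every node is either the root or a child, and either internal or a leaf. -/
theorem sum_root_add_sum_nonroot
    (hroot : ∀ i j, T i 0 = T j 0)
    (hprefix : ∀ i j k k', k ≤ d i → k' ≤ d j → T i k = T j k' →
      k = k' ∧ ∀ l ≤ k, T i l = T j l)
    (hleaf : ∀ i j k, k ≤ d j → T i (d i) = T j k → i = j ∧ k = d j) (i₀ : Fin M)
    (h : α → ℝ) :
    h (T i₀ 0) + ∑ a ∈ (internalPos d).image (fun x => T x.1 (x.2 + 1)), h a
      = ∑ a ∈ (internalPos d).image (fun x => T x.1 x.2), h a + ∑ i, h (T i (d i)) := by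
  have hinj : Function.Injective fun i => T i (d i) :=
    fun i j hij => (hleaf i j (d j) le_rfl hij).1
  rw [← sum_image (f := h) (s := univ) (g := fun i => T i (d i)) hinj.injOn, ← sum_union,
    ← sum_insert]
  · congr 1
    ext a
    simp only [mem_insert, mem_union, mem_image, mem_internalPos, Sigma.exists, mem_univ,
      true_and]
    constructor
    · rintro (rfl | ⟨i, k, hk, rfl⟩)
      · rcases Nat.eq_zero_or_pos (d i₀) with h0 | h0
        · exact Or.inr ⟨i₀, by rw [h0]⟩
        · exact Or.inl ⟨i₀, 0, h0, rfl⟩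
      · rcases Nat.lt_or_ge (k + 1) (d i) with h1 | h1
        · exact Or.inl ⟨i, k + 1, h1, rfl⟩
        · exact Or.inr ⟨i, by rw [show d i = k + 1 by omega]⟩
    · have key : ∀ i k, k ≤ d i → T i k = T i₀ 0 ∨ ∃ j l, l < d j ∧ T j (l + 1) = T i k := by
        rintro i (_ | k) hk
        · exact Or.inl (hroot _ _)
        · exact Or.inr ⟨i, k, hk, rfl⟩
      rintro (⟨i, k, hk, rfl⟩ | ⟨i, rfl⟩)
      · exact key i k hk.le
      · exact key i _ le_rfl
  · simp only [mem_image, mem_internalPos, Sigma.exists, not_exists, not_and]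
    intro i k hk heq
    exact absurd (hprefix i i₀ (k + 1) 0 hk (Nat.zero_le _) heq).1 (by omega)
  · refine disjoint_left.2 fun a ha hb => ?_
    simp only [mem_image, mem_internalPos, Sigma.exists, mem_univ, true_and] at ha hb
    obtain ⟨i, k, hk, rfl⟩ := ha
    obtain ⟨j, hj⟩ := hb
    exact hk.ne (hleaf j i k hk.le hj).2

end PathStructure

/-- **Unbiasedness of the single-path stochastic Barnes-Hut estimator.**
The expectation of `F̂₁(q)` over the path index `I` (sampled with probabilities `w i > 0`)
and the Russian roulette path length `K` equals the kernel sum `F(q) = ∑ i, m i f(p i, q)`. -/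
theorem single_path_estimator_unbiased
    (M : ℕ) (hM : 1 ≤ M) {α : Type*}
    (p : Fin M → EuclideanSpace ℝ (Fin 3)) (m : Fin M → ℝ)
    (f : EuclideanSpace ℝ (Fin 3) → EuclideanSpace ℝ (Fin 3) → ℝ)
    (q : EuclideanSpace ℝ (Fin 3))
    (d : Fin M → ℕ) (T : Fin M → ℕ → α)
    -- all paths share a common root
    (hroot : ∀ i j, T i 0 = T j 0)
    -- paths are prefix-consistent
    (hprefix : ∀ i j k k', k ≤ d i → k' ≤ d j → T i k = T j k' →
      k = k' ∧ ∀ l ≤ k, T i l = T j l)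
    -- leaves identify sources
    (hleaf : ∀ i j k, k ≤ d j → T i (d i) = T j k → i = j ∧ k = d j)
    -- every node's aggregate mass is positive
    (hmass : ∀ i k, k ≤ d i → 0 < aggMass d T m (T i k))
    -- leaf centers of mass coincide with the corresponding source points
    (hcom : ∀ i, com d T m p (T i (d i)) = p i)
    -- path-index sampling probabilities, all positive
    (w : Fin M → ℝ) (hw : ∀ i, 0 < w i) (hw1 : ∑ i, w i = 1)
    -- Russian roulette continuation probabilities in (0, 1]
    (prr : Fin M → ℕ → ℝ) (hprr : ∀ i k, k < d i → 0 < prr i k ∧ prr i k ≤ 1) :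
    ∑ i, ∑ ℓ ∈ Finset.range (d i + 1),
        (w i * lenProb d prr i ℓ) * pathEstimate d T m p f q w prr i ℓ
      = ∑ i, m i * f (p i) q := by
  classical
  set h : α → ℝ := fun a => aggMass d T m a * f (com d T m p a) q with hh
  have i₀ : Fin M := ⟨0, hM⟩
  have hleafval : ∀ i, h (T i (d i)) = m i * f (p i) q := fun i => by
    simp only [hh, hcom, aggMass, nodeSet_leaf hleaf, sum_singleton]
  have hswap : ∀ i k, contribSwap d T m p f q i k
      = ∑ c ∈ children d T (T i k), h c - h (T i k) := fun _ _ => rfl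
  have hinternal := sum_internalPos_div hprefix hleaf w hw
    fun a => ∑ c ∈ children d T a, h c - h a
  rw [sum_sub_distrib, sum_children hprefix, internalPos, sum_sigma, ← internalPos] at hinternal
  have hnodes := sum_root_add_sum_nonroot hroot hprefix hleaf i₀ h
  calc ∑ i, ∑ ℓ ∈ range (d i + 1),
        (w i * lenProb d prr i ℓ) * pathEstimate d T m p f q w prr i ℓ
      = ∑ i, (w i * h (T i₀ 0) + ∑ k ∈ range (d i),
          w i * ((∑ c ∈ children d T (T i k), h c - h (T i k)) /
            ∑ j ∈ nodeSet d T (T i k), w j)) := by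
        refine sum_congr rfl fun i _ => ?_
        simp only [mul_assoc, ← mul_sum]
        rw [sum_lenProb_mul_pathEstimate d T m p f q w prr i fun k hk => (hprr i k hk).1.ne',
          mul_add, hroot i i₀]
        simp only [hswap]
        rfl
    _ = ∑ i, h (T i (d i)) := by
        rw [sum_add_distrib, ← sum_mul, hw1, one_mul, hinternal]
        linarith
    _ = ∑ i, m i * f (p i) q := sum_congr rfl fun i _ => hleafval i
end
end

section
/- Let a path structure on sources p_1,…,p_M with masses m_1,…,m_M be given (prefix-consistent paths, leaves identify sources, positive aggregate masses, leaf centers equal to source points), and let R be a finite set of nodes (the subdomain roots) whose point sets {T_a : a ∈ R} form a partition of {1,…,M}. For each a ∈ R let F̂₁^{(a)}(q) be the single-path estimator applied to the subtree rooted at a (paths sampled among indices in T_a with positive probabilities, Russian roulette with continuation probabilities in (0,1]), sampled independently across subdomains. Then the stratified estimator F̂(q) = Σ_{a ∈ R} F̂₁^{(a)}(q) satisfies E[F̂(q)] = F(q) = Σ_{i=1}^{M} m_i f(p_i, q). -/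
open Finset

noncomputable section

/-- The Russian roulette path-length distribution for a path started at absolute depth `s`
along source `i`'s path: `P(K = ℓ)` where the process continues from relative depth `k`
with probability `prr i (s + k)` and stops with certainty at the leaf. -/
def subLenProb {M : ℕ} (d : Fin M → ℕ) (prr : Fin M → ℕ → ℝ) (s : ℕ) (i : Fin M)
    (ℓ : ℕ) : ℝ :=
  if ℓ < d i - s then (∏ j ∈ Finset.range ℓ, prr i (s + j)) * (1 - prr i (s + ℓ))
  else ∏ j ∈ Finset.range (d i - s), prr i (s + j)

/-- The value of the single-path estimator rooted at subdomain node `a`, for the sample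
path index `i` (whose path reaches `a` at depth `s`) and relative path length `ℓ`:
`m̃_a f(p̃_a, q) + ∑_{k=1}^{ℓ} Δ_{i,s+k-1} / (P(I ∈ T_{i,s+k-1}) · P(K ≥ k ∣ I = i))`. -/
def subPathEstimate {M : ℕ} {α : Type*} (d : Fin M → ℕ) (T : Fin M → ℕ → α)
    (m : Fin M → ℝ) (p : Fin M → EuclideanSpace ℝ (Fin 3))
    (f : EuclideanSpace ℝ (Fin 3) → EuclideanSpace ℝ (Fin 3) → ℝ)
    (q : EuclideanSpace ℝ (Fin 3)) (prr : Fin M → ℕ → ℝ) (a : α) (s : ℕ)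
    (w : Fin M → ℝ) (i : Fin M) (ℓ : ℕ) : ℝ :=
  aggMass d T m a * f (com d T m p a) q +
    ∑ k ∈ Finset.Icc 1 ℓ,
      contribSwap d T m p f q i (s + k - 1) /
        ((∑ j ∈ nodeSet d T (T i (s + k - 1)), w j) * ∏ j ∈ Finset.range k, prr i (s + j))


theorem sum_stopping_mul_eq_telescope (r G : ℕ → ℝ) (n : ℕ) :
    ∑ l ∈ range n, (∏ j ∈ range l, r j) * (1 - r l) * G l + (∏ j ∈ range n, r j) * G n =
      G 0 + ∑ k ∈ range n, (∏ j ∈ range (k + 1), r j) * (G (k + 1) - G k) := by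
  induction n with
  | zero => simp
  | succ n ih =>
    rw [sum_range_succ, sum_range_succ, ← add_assoc, ← ih, prod_range_succ]
    ring

theorem sum_subLenProb_mul {M : ℕ} (d : Fin M → ℕ) (prr : Fin M → ℕ → ℝ) (s : ℕ) (i : Fin M)
    (G : ℕ → ℝ) :
    ∑ l ∈ range (d i - s + 1), subLenProb d prr s i l * G l =
      G 0 + ∑ k ∈ range (d i - s),
        (∏ j ∈ range (k + 1), prr i (s + j)) * (G (k + 1) - G k) := by
  rw [← sum_stopping_mul_eq_telescope (fun j => prr i (s + j)), sum_range_succ]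
  congr 1
  · refine sum_congr rfl fun l hl => ?_
    rw [subLenProb, if_pos (mem_range.1 hl)]
  · rw [subLenProb, if_neg (lt_irrefl _)]

theorem sum_subLenProb_mul_subPathEstimate {M : ℕ} {α : Type*} (d : Fin M → ℕ)
    (T : Fin M → ℕ → α) (m : Fin M → ℝ) (p : Fin M → EuclideanSpace ℝ (Fin 3))
    (f : EuclideanSpace ℝ (Fin 3) → EuclideanSpace ℝ (Fin 3) → ℝ)
    (q : EuclideanSpace ℝ (Fin 3)) (prr : Fin M → ℕ → ℝ) (a : α) (s : ℕ)
    (w : Fin M → ℝ) (i : Fin M) (hprr : ∀ k, k < d i → prr i k ≠ 0) :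
    ∑ l ∈ range (d i - s + 1),
        subLenProb d prr s i l * subPathEstimate d T m p f q prr a s w i l =
      aggMass d T m a * f (com d T m p a) q +
        ∑ k ∈ Ico s (d i), contribSwap d T m p f q i k / ∑ j ∈ nodeSet d T (T i k), w j := by
  rw [sum_subLenProb_mul, sum_Ico_eq_sum_range]
  congr 1
  · simp [subPathEstimate]
  · refine sum_congr rfl fun k hk => ?_
    have hQ : ∏ j ∈ range (k + 1), prr i (s + j) ≠ 0 := by
      refine prod_ne_zero_iff.2 fun j hj => hprr _ ?_
      rw [mem_range] at hk hj
      omega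
    have hs : s + (k + 1) - 1 = s + k := rfl
    rw [subPathEstimate, subPathEstimate, sum_Icc_succ_top (by omega), hs,
      add_sub_add_left_eq_sub, add_sub_cancel_left, mul_div_assoc', mul_comm,
      mul_div_mul_right _ _ hQ]

section PathTree

variable {M : ℕ} {α : Type*} {d : Fin M → ℕ} {T : Fin M → ℕ → α}

theorem mem_nodeSet_iff
    (hprefix : ∀ i j k k', k ≤ d i → k' ≤ d j → T i k = T j k' →
      k = k' ∧ ∀ l ≤ k, T i l = T j l)
    {i j : Fin M} {k : ℕ} (hk : k ≤ d i) :
    j ∈ nodeSet d T (T i k) ↔ k ≤ d j ∧ T j k = T i k := by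
  simp only [nodeSet, mem_filter, mem_univ, true_and]
  refine ⟨fun ⟨k', hk', h⟩ => ?_, fun h => ⟨k, h⟩⟩
  obtain ⟨rfl, -⟩ := hprefix j i k' k hk' hk h
  exact ⟨hk', h⟩

theorem lt_depth_of_mem_nodeSet
    (hprefix : ∀ i j k k', k ≤ d i → k' ≤ d j → T i k = T j k' →
      k = k' ∧ ∀ l ≤ k, T i l = T j l)
    (hleaf : ∀ i j k, k ≤ d j → T i (d i) = T j k → i = j ∧ k = d j)
    {i j : Fin M} {k : ℕ} (hk : k < d i) (hj : j ∈ nodeSet d T (T i k)) : k < d j := by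
  obtain ⟨hkj, h⟩ := (mem_nodeSet_iff hprefix hk.le).1 hj
  refine lt_of_le_of_ne hkj ?_
  rintro rfl
  exact hk.ne (hleaf j i _ hk.le h).2

theorem mem_children_iff
    (hprefix : ∀ i j k k', k ≤ d i → k' ≤ d j → T i k = T j k' →
      k = k' ∧ ∀ l ≤ k, T i l = T j l)
    {i : Fin M} {k : ℕ} (hk : k ≤ d i) {c : α} :
    c ∈ children d T (T i k) ↔ ∃ j, k + 1 ≤ d j ∧ T j k = T i k ∧ T j (k + 1) = c := by
  simp only [children, mem_image, mem_filter, mem_product, mem_univ, true_and, mem_range,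
    Prod.exists]
  constructor
  · rintro ⟨j, k', ⟨-, hk', h⟩, hc⟩
    obtain ⟨rfl, -⟩ := hprefix j i k' k (by omega) hk h
    exact ⟨j, hk', h, hc⟩
  · rintro ⟨j, hj, h, hc⟩
    exact ⟨j, k, ⟨by have := le_sup (f := d) (mem_univ j); omega, hj, h⟩, hc⟩

theorem sum_nodeSet_eq_sum_children
    (hprefix : ∀ i j k k', k ≤ d i → k' ≤ d j → T i k = T j k' →
      k = k' ∧ ∀ l ≤ k, T i l = T j l)
    (hleaf : ∀ i j k, k ≤ d j → T i (d i) = T j k → i = j ∧ k = d j)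
    {i : Fin M} {k : ℕ} (hk : k < d i) (F : Fin M → ℝ) :
    ∑ j ∈ nodeSet d T (T i k), F j =
      ∑ c ∈ children d T (T i k), ∑ j ∈ nodeSet d T c, F j := by
  classical
  have hmaps : ∀ j ∈ nodeSet d T (T i k), T j (k + 1) ∈ children d T (T i k) := fun j hj =>
    (mem_children_iff hprefix hk.le).2 ⟨j, lt_depth_of_mem_nodeSet hprefix hleaf hk hj,
      ((mem_nodeSet_iff hprefix hk.le).1 hj).2, rfl⟩
  rw [← sum_fiberwise_of_maps_to hmaps]
  refine sum_congr rfl fun c hc => sum_congr ?_ fun _ _ => rfl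
  obtain ⟨j, hj, hji, rfl⟩ := (mem_children_iff hprefix hk.le).1 hc
  ext l
  rw [mem_filter, mem_nodeSet_iff hprefix hj, mem_nodeSet_iff hprefix hk.le]
  constructor
  · rintro ⟨⟨hl, hli⟩, h⟩
    exact ⟨lt_depth_of_mem_nodeSet hprefix hleaf hk
      ((mem_nodeSet_iff hprefix hk.le).2 ⟨hl, hli⟩), h⟩
  · rintro ⟨hl, h⟩
    exact ⟨⟨by omega, ((hprefix l j _ _ hl hj h).2 k (by omega)).trans hji⟩, h⟩

/-- Averaging the inverse-probability-weighted contribution swaps over all paths below a node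
replaces the contribution of that node by the contributions of its sources. -/
theorem sum_nodeSet_contribSwap
    (hprefix : ∀ i j k k', k ≤ d i → k' ≤ d j → T i k = T j k' →
      k = k' ∧ ∀ l ≤ k, T i l = T j l)
    (hleaf : ∀ i j k, k ≤ d j → T i (d i) = T j k → i = j ∧ k = d j)
    (m : Fin M → ℝ) (p : Fin M → EuclideanSpace ℝ (Fin 3))
    (hcom : ∀ i, com d T m p (T i (d i)) = p i)
    (f : EuclideanSpace ℝ (Fin 3) → EuclideanSpace ℝ (Fin 3) → ℝ)
    (q : EuclideanSpace ℝ (Fin 3)) (w : Fin M → ℝ) (i : Fin M) (k : ℕ) (hk : k ≤ d i)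
    (hw : ∀ j ∈ nodeSet d T (T i k), 0 < w j) :
    ∑ j ∈ nodeSet d T (T i k), w j * ∑ l ∈ Ico k (d j),
        contribSwap d T m p f q j l / ∑ j' ∈ nodeSet d T (T j l), w j' =
      ∑ j ∈ nodeSet d T (T i k), m j * f (p j) q -
        aggMass d T m (T i k) * f (com d T m p (T i k)) q := by
  obtain ⟨n, hn⟩ : ∃ n, ∀ j, d j ≤ k + n :=
    ⟨univ.sup d, fun j => (le_sup (f := d) (mem_univ j)).trans (Nat.le_add_left _ _)⟩
  induction n generalizing i k with
  | zero =>
    obtain rfl : k = d i := le_antisymm hk (hn i)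
    simp [nodeSet_leaf hleaf, aggMass, hcom]
  | succ n ih =>
    obtain rfl | hlt := hk.eq_or_lt
    · simp [nodeSet_leaf hleaf, aggMass, hcom]
    have hi : i ∈ nodeSet d T (T i k) := (mem_nodeSet_iff hprefix hk).2 ⟨hk, rfl⟩
    have hW : ∑ j ∈ nodeSet d T (T i k), w j ≠ 0 := (sum_pos hw ⟨i, hi⟩).ne'
    have hchild : ∀ c ∈ children d T (T i k),
        ∑ j ∈ nodeSet d T c, w j * ∑ l ∈ Ico (k + 1) (d j),
          contribSwap d T m p f q j l / ∑ j' ∈ nodeSet d T (T j l), w j' =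
        ∑ j ∈ nodeSet d T c, m j * f (p j) q -
          aggMass d T m c * f (com d T m p c) q := by
      intro c hc
      obtain ⟨j, hj, hji, rfl⟩ := (mem_children_iff hprefix hk).1 hc
      refine ih j (k + 1) hj (fun l hl => hw l ?_) fun l => by have := hn l; omega
      obtain ⟨hl, h⟩ := (mem_nodeSet_iff hprefix hj).1 hl
      exact (mem_nodeSet_iff hprefix hk).2
        ⟨by omega, ((hprefix l j _ _ hl hj h).2 k (by omega)).trans hji⟩
    have hsplit : ∀ j ∈ nodeSet d T (T i k),
        w j * ∑ l ∈ Ico k (d j),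
          contribSwap d T m p f q j l / ∑ j' ∈ nodeSet d T (T j l), w j' =
        w j * (contribSwap d T m p f q i k / ∑ j' ∈ nodeSet d T (T i k), w j') +
          w j * ∑ l ∈ Ico (k + 1) (d j),
            contribSwap d T m p f q j l / ∑ j' ∈ nodeSet d T (T j l), w j' := by
      intro j hj
      have hT := ((mem_nodeSet_iff hprefix hk).1 hj).2
      rw [sum_eq_sum_Ico_succ_bot (lt_depth_of_mem_nodeSet hprefix hleaf hlt hj), mul_add,
        contribSwap, hT, contribSwap]
    rw [sum_congr rfl hsplit, sum_add_distrib, ← sum_mul, mul_div_cancel₀ _ hW,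
      sum_nodeSet_eq_sum_children hprefix hleaf hlt, sum_congr rfl hchild, sum_sub_distrib,
      ← sum_nodeSet_eq_sum_children hprefix hleaf hlt, contribSwap]
    ring

end PathTree

/-- **Unbiasedness of the stratified (domain-stratified) estimator.** Given subdomain
roots `R` whose point sets partition the sources, with each subdomain running an
independent single-path estimator rooted at that subdomain, the expectation of the sum of
the subdomain estimators equals the kernel sum `F(q) = ∑ i, m i f(p i, q)`. (By linearity
of expectation over the independent subdomain samples, the expectation of the sum is the
sum of the per-subdomain expectations, which is the left-hand side below.) -/
theorem stratified_estimator_unbiased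
    (M : ℕ) {α : Type*}
    (p : Fin M → EuclideanSpace ℝ (Fin 3)) (m : Fin M → ℝ)
    (f : EuclideanSpace ℝ (Fin 3) → EuclideanSpace ℝ (Fin 3) → ℝ)
    (q : EuclideanSpace ℝ (Fin 3))
    (d : Fin M → ℕ) (T : Fin M → ℕ → α)
    -- paths are prefix-consistent
    (hprefix : ∀ i j k k', k ≤ d i → k' ≤ d j → T i k = T j k' →
      k = k' ∧ ∀ l ≤ k, T i l = T j l)
    -- leaves identify sources
    (hleaf : ∀ i j k, k ≤ d j → T i (d i) = T j k → i = j ∧ k = d j)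
    -- every node's aggregate mass is positive
    (hmass : ∀ i k, k ≤ d i → 0 < aggMass d T m (T i k))
    -- leaf centers of mass coincide with the corresponding source points
    (hcom : ∀ i, com d T m p (T i (d i)) = p i)
    -- the subdomain roots, whose point sets partition the sources
    (R : Finset α)
    (hdisj : ∀ a ∈ R, ∀ b ∈ R, a ≠ b → Disjoint (nodeSet d T a) (nodeSet d T b))
    (hcover : R.biUnion (nodeSet d T) = Finset.univ)
    -- the depth at which each source's path reaches its subdomain root
    (sd : α → Fin M → ℕ)
    (hsd : ∀ a ∈ R, ∀ i ∈ nodeSet d T a, sd a i ≤ d i ∧ T i (sd a i) = a)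
    -- per-subdomain path-index sampling probabilities, positive on the subdomain
    (w : α → Fin M → ℝ)
    (hw : ∀ a ∈ R, ∀ i ∈ nodeSet d T a, 0 < w a i)
    (hw1 : ∀ a ∈ R, ∑ i ∈ nodeSet d T a, w a i = 1)
    -- Russian roulette continuation probabilities in (0, 1]
    (prr : Fin M → ℕ → ℝ) (hprr : ∀ i k, k < d i → 0 < prr i k ∧ prr i k ≤ 1) :
    ∑ a ∈ R, ∑ i ∈ nodeSet d T a, ∑ ℓ ∈ Finset.range (d i - sd a i + 1),
        (w a i * subLenProb d prr (sd a i) i ℓ) *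
          subPathEstimate d T m p f q prr a (sd a i) (w a) i ℓ
      = ∑ i, m i * f (p i) q := by
  rw [← hcover, sum_biUnion fun a ha b hb hab => hdisj a ha b hb hab]
  refine sum_congr rfl fun a ha => ?_
  obtain hempty | ⟨i, hi⟩ := (nodeSet d T a).eq_empty_or_nonempty
  · simp [hempty]
  obtain ⟨hs, hTa⟩ := hsd a ha i hi
  have hsd_eq : ∀ j ∈ nodeSet d T a, sd a j = sd a i := fun j hj =>
    (hprefix j i _ _ (hsd a ha j hj).1 hs ((hsd a ha j hj).2.trans hTa.symm)).1
  have hexp : ∀ j ∈ nodeSet d T a,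
      ∑ l ∈ range (d j - sd a j + 1), (w a j * subLenProb d prr (sd a j) j l) *
          subPathEstimate d T m p f q prr a (sd a j) (w a) j l =
        w a j * (aggMass d T m a * f (com d T m p a) q) +
          w a j * ∑ k ∈ Ico (sd a i) (d j),
            contribSwap d T m p f q j k / ∑ j' ∈ nodeSet d T (T j k), w a j' := by
    intro j hj
    simp_rw [mul_assoc, ← mul_sum]
    rw [sum_subLenProb_mul_subPathEstimate d T m p f q prr a _ _ _
      fun k hk => (hprr j k hk).1.ne', mul_add, hsd_eq j hj]
  have hswap := sum_nodeSet_contribSwap hprefix hleaf m p hcom f q (w a) i (sd a i) hs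
    (by rw [hTa]; exact hw a ha)
  rw [hTa] at hswap
  rw [sum_congr rfl hexp, sum_add_distrib, ← sum_mul, hw1 a ha, hswap]
  ring
end
end

section
/- Let a prefix-consistent path structure on sources p_1,…,p_M with masses m_1,…,m_M be given, and let truncation lengths ℓ_1,…,ℓ_M (with ℓ_i ≤ d_i) satisfy the consistency condition: whenever source j's path passes through the node T_{i,ℓ_i} (i.e. j ∈ T_{T_{i,ℓ_i}}), then ℓ_j = ℓ_i and T_{j,ℓ_j} = T_{i,ℓ_i}. Let D = {T_{i,ℓ_i} : 1 ≤ i ≤ M} be the resulting set of contribution nodes. Then the sum of the truncated telescoping path sums equals the Barnes-Hut sum over contribution nodes: Σ_{i=1}^{M} [ m_i f(p̃_{T_{i,0}}, q) + Σ_{k=1}^{ℓ_i} m_i ( f(p̃_{T_{i,k}}, q) − f(p̃_{T_{i,k−1}}, q) ) ] = Σ_{a ∈ D} m̃_a f(p̃_a, q). -/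
open Finset

noncomputable section

/-- A sum telescoping along `1, …, n`, started from its zeroth term. -/
theorem mul_add_sum_Icc_mul_sub (c : ℝ) (g : ℕ → ℝ) (n : ℕ) :
    c * g 0 + ∑ k ∈ Finset.Icc 1 n, c * (g k - g (k - 1)) = c * g n := by
  induction n with
  | zero => simp
  | succ n ih =>
    rw [Finset.sum_Icc_succ_top (by omega), ← add_assoc, ih, Nat.add_sub_cancel]
    ring

/-- The sources truncated at a contribution node are exactly those whose path passes
through it. -/
theorem filter_eq_nodeSet {M : ℕ} {α : Type*} [DecidableEq α]
    {d : Fin M → ℕ} {T : Fin M → ℕ → α} {tr : Fin M → ℕ} (htr : ∀ i, tr i ≤ d i)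
    {i : Fin M} (h : ∀ j, j ∈ nodeSet d T (T i (tr i)) → T j (tr j) = T i (tr i)) :
    Finset.univ.filter (fun j => T j (tr j) = T i (tr i)) = nodeSet d T (T i (tr i)) := by
  ext j
  refine ⟨fun hj => ?_, fun hj => by simpa using h j hj⟩
  simp only [nodeSet, Finset.mem_filter, Finset.mem_univ, true_and] at hj ⊢
  exact ⟨tr j, htr j, hj⟩

open Classical in
/-- **Truncated telescoping path sums equal the Barnes-Hut sum.** Given consistent
truncation lengths `ℓ i ≤ d i` (whenever source `j`'s path passes through the node
`T_{i, ℓ i}`, source `j` is truncated at that same node), the sum over sources of the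
truncated telescoping path sums equals the Barnes-Hut sum over the set of contribution
nodes `D = {T_{i, ℓ i} : i}`. -/
theorem truncated_paths_eq_barnes_hut
    (M : ℕ) {α : Type*}
    (p : Fin M → EuclideanSpace ℝ (Fin 3)) (m : Fin M → ℝ)
    (f : EuclideanSpace ℝ (Fin 3) → EuclideanSpace ℝ (Fin 3) → ℝ)
    (q : EuclideanSpace ℝ (Fin 3))
    (d : Fin M → ℕ) (T : Fin M → ℕ → α)
    -- all paths share a common root
    (hroot : ∀ i j, T i 0 = T j 0)
    -- paths are prefix-consistent
    (hprefix : ∀ i j k k', k ≤ d i → k' ≤ d j → T i k = T j k' →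
      k = k' ∧ ∀ l ≤ k, T i l = T j l)
    -- every node's aggregate mass is positive
    (hmass : ∀ i k, k ≤ d i → 0 < aggMass d T m (T i k))
    -- truncation lengths
    (tr : Fin M → ℕ) (htr : ∀ i, tr i ≤ d i)
    -- consistency: sources passing through a contribution node are truncated there
    (hconsist : ∀ i j, j ∈ nodeSet d T (T i (tr i)) →
      tr j = tr i ∧ T j (tr j) = T i (tr i)) :
    ∑ i, (m i * f (com d T m p (T i 0)) q +
        ∑ k ∈ Finset.Icc 1 (tr i),
          m i * (f (com d T m p (T i k)) q - f (com d T m p (T i (k - 1))) q))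
      = ∑ a ∈ Finset.image (fun i => T i (tr i)) Finset.univ,
          aggMass d T m a * f (com d T m p a) q := by
  calc
    _ = ∑ i, m i * f (com d T m p (T i (tr i))) q :=
      Finset.sum_congr rfl fun i _ =>
        mul_add_sum_Icc_mul_sub (m i) (fun k => f (com d T m p (T i k)) q) (tr i)
    _ = ∑ a ∈ Finset.image (fun i => T i (tr i)) Finset.univ,
          ∑ j ∈ Finset.univ.filter (fun j => T j (tr j) = a),
            m j * f (com d T m p (T j (tr j))) q :=
      (Finset.sum_fiberwise_of_maps_to
        (fun i hi => Finset.mem_image_of_mem (fun i => T i (tr i)) hi) _).symm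
    _ = _ := by
      refine Finset.sum_congr rfl fun a ha => ?_
      obtain ⟨i, -, rfl⟩ := Finset.mem_image.1 ha
      rw [aggMass, Finset.sum_mul, ← filter_eq_nodeSet htr fun j hj => (hconsist i j hj).2]
      exact Finset.sum_congr rfl fun j hj => by rw [(Finset.mem_filter.1 hj).2]
end
end
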